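/- arXiv:2307.08053 — 2 statements merged into one kernel-verified Lean document; each statement's English description precedes it below -/
import Mathlib

section
/- Let q > 3 be a prime power and α a primitive element of GF(q). Let C_α be the [q, 3, q-2] code spanned by the rows of the 3×q matrix G_α whose columns are (0,0,1)^T and (α^{2i}, α^i, 1)^T for 0 ≤ i ≤ q-2. Then the all-one vector 1 lies in C_α^⊥, i.e. the standardly extended code of C_α is trivial. Moreover, for u^{(1)} = -(0, 1, α^{-2}, ..., α^{-2(q-2)}), the extended code C̄_α(u^{(1)}) has parameters [q+1, 3, q-1] and its dual has parameters [q+1, q-2, 4]. -/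
open Finset

variable {F : Type*} [Field F] [Fintype F] [DecidableEq F]

/-- The extended code of `C` by the vector `u`: append the coordinate `∑ uᵢ cᵢ`. -/
def extCode {n : ℕ} (C : Submodule F (Fin n → F)) (u : Fin n → F) :
    Submodule F (Fin (n + 1) → F) where
  carrier := {x | (fun i => x i.castSucc) ∈ C ∧
    x (Fin.last n) = ∑ i, u i * x i.castSucc}
  add_mem' := by
    rintro a b ⟨ha, ha'⟩ ⟨hb, hb'⟩
    refine ⟨C.add_mem ha hb, ?_⟩
    simp only [Pi.add_apply, ha', hb', mul_add, Finset.sum_add_distrib]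
  zero_mem' := ⟨C.zero_mem, by simp⟩
  smul_mem' := by
    rintro a x ⟨hx, hx'⟩
    refine ⟨C.smul_mem a hx, ?_⟩
    simp only [Pi.smul_apply, smul_eq_mul, hx', Finset.mul_sum]
    exact Finset.sum_congr rfl fun i _ => by ring

/-- The (Euclidean) dual code. -/
def dualCode {n : ℕ} (C : Submodule F (Fin n → F)) : Submodule F (Fin n → F) where
  carrier := {x | ∀ c ∈ C, ∑ i, x i * c i = 0}
  add_mem' := by
    intro a b ha hb c hc
    simp only [Pi.add_apply, add_mul, Finset.sum_add_distrib, ha c hc, hb c hc, add_zero]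
  zero_mem' := by intro c hc; simp
  smul_mem' := by
    intro a x hx c hc
    simp only [Pi.smul_apply, smul_eq_mul, mul_assoc, ← Finset.mul_sum, hx c hc, mul_zero]

/-- Minimum (Hamming) distance of a linear code: least weight of a nonzero codeword. -/
noncomputable def minDist {n : ℕ} (C : Submodule F (Fin n → F)) : ℕ :=
  sInf {w | ∃ c ∈ C, c ≠ 0 ∧ hammingNorm c = w}

/-- Number of codewords of Hamming weight `w`. -/
noncomputable def weightCount {n : ℕ} (C : Submodule F (Fin n → F)) (w : ℕ) : ℕ :=
  Nat.card {c : C // hammingNorm (c : Fin n → F) = w}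

/-- The evaluation code of the binary quadratic forms at the points `(s i : t i)`. -/
def conicCode {K : Type*} [Field K] {n : ℕ} (s t : Fin n → K) : Submodule K (Fin n → K) :=
  LinearMap.range (Matrix.rectVandermonde s t 3).mulVecLin

lemma rectVandermonde_three_mulVec {K : Type*} [Field K]
    {n : ℕ} (s t : Fin n → K) (v : Fin 3 → K) (i : Fin n) :
    (Matrix.rectVandermonde s t 3).mulVec v i =
      v 2 * s i ^ 2 + v 1 * (s i * t i) + v 0 * t i ^ 2 := by
  simp only [Matrix.mulVec, dotProduct, Fin.sum_univ_three, Matrix.rectVandermonde_apply]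
  simp
  ring

lemma mem_conicCode_iff {K : Type*} [Field K] {n : ℕ} {s t : Fin n → K} {x : Fin n → K} :
    x ∈ conicCode s t ↔
      ∃ a b c : K, ∀ i, x i = a * s i ^ 2 + b * (s i * t i) + c * t i ^ 2 := by
  constructor
  · rintro ⟨v, rfl⟩
    exact ⟨v 2, v 1, v 0, rectVandermonde_three_mulVec s t v⟩
  · rintro ⟨a, b, c, h⟩
    refine ⟨![c, b, a], funext fun i => ?_⟩
    rw [Matrix.mulVecLin_apply, rectVandermonde_three_mulVec, h i]
    simp

/-- The product of the linear forms vanishing at the points `j` and `k`. -/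
lemma mul_sub_mul_mem_conicCode {K : Type*} [Field K] {n : ℕ} (s t : Fin n → K) (j k : Fin n) :
    (fun i => (s i * t j - s j * t i) * (s i * t k - s k * t i)) ∈ conicCode s t :=
  mem_conicCode_iff.2 ⟨t j * t k, -(t j * s k + s j * t k), s j * s k, fun i => by ring⟩

/-- A quadratic form vanishing at three distinct points of the projective line is zero. -/
lemma eq_zero_of_rectVandermonde_mulVec_eq_zero {K : Type*} [Field K] {n : ℕ} {s t : Fin n → K}
    (hst : ∀ i j, i ≠ j → s i * t j - s j * t i ≠ 0) {v : Fin 3 → K} {i j k : Fin n}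
    (hij : i ≠ j) (hik : i ≠ k) (hjk : j ≠ k)
    (hi : (Matrix.rectVandermonde s t 3).mulVec v i = 0)
    (hj : (Matrix.rectVandermonde s t 3).mulVec v j = 0)
    (hk : (Matrix.rectVandermonde s t 3).mulVec v k = 0) : v = 0 := by
  refine Matrix.eq_zero_of_mulVec_eq_zero
    (M := Matrix.projVandermonde (s ∘ ![i, j, k]) (t ∘ ![i, j, k])) ?_ ?_
  · rw [Matrix.det_projVandermonde, Finset.prod_ne_zero_iff]
    refine fun a _ => Finset.prod_ne_zero_iff.2 fun b hb => ?_
    have hab : ![i, j, k] b ≠ ![i, j, k] a := by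
      have := Finset.mem_Ioi.1 hb
      fin_cases a <;> fin_cases b <;> simp_all [Ne.symm]
    exact hst _ _ hab
  · ext a
    change (Matrix.rectVandermonde s t 3).mulVec v (![i, j, k] a) = 0
    fin_cases a
    exacts [hi, hj, hk]

lemma exists_three_distinct {n : ℕ} (hn : 3 ≤ n) :
    ∃ i j k : Fin n, i ≠ j ∧ i ≠ k ∧ j ≠ k :=
  ⟨⟨0, by lia⟩, ⟨1, by lia⟩, ⟨2, by lia⟩, by simp, by simp, by simp⟩

lemma finrank_conicCode {K : Type*} [Field K] {n : ℕ} (hn : 3 ≤ n) {s t : Fin n → K}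
    (hst : ∀ i j, i ≠ j → s i * t j - s j * t i ≠ 0) :
    Module.finrank K (conicCode s t) = 3 := by
  obtain ⟨i, j, k, hij, hik, hjk⟩ := exists_three_distinct hn
  rw [conicCode, LinearMap.finrank_range_of_inj, Module.finrank_fin_fun]
  refine (injective_iff_map_eq_zero _).2 fun v hv => ?_
  rw [Matrix.mulVecLin_apply] at hv
  exact eq_zero_of_rectVandermonde_mulVec_eq_zero hst hij hik hjk
    (congrFun hv i) (congrFun hv j) (congrFun hv k)

lemma minDist_eq_of_forall_le {K : Type*} [Field K] [DecidableEq K]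
    {n d : ℕ} {C : Submodule K (Fin n → K)} {c : Fin n → K}
    (hc : c ∈ C) (hc0 : c ≠ 0) (hcd : hammingNorm c ≤ d)
    (h : ∀ x ∈ C, x ≠ 0 → d ≤ hammingNorm x) : minDist C = d := by
  refine IsLeast.csInf_eq ⟨⟨c, hc, hc0, le_antisymm hcd (h c hc hc0)⟩, ?_⟩
  rintro _ ⟨x, hx, hx0, rfl⟩
  exact h x hx hx0

lemma hammingNorm_add_card_zeros {K : Type*} [Field K] [DecidableEq K] {n : ℕ} (x : Fin n → K) :
    hammingNorm x + #{i | x i = 0} = n := by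
  have h := Finset.card_filter_add_card_filter_not (s := (univ : Finset (Fin n))) (fun i => x i = 0)
  rw [Finset.card_fin] at h
  rw [add_comm]
  exact h

lemma minDist_conicCode {K : Type*} [Field K] [DecidableEq K] {n : ℕ} (hn : 3 ≤ n) {s t : Fin n → K}
    (hst : ∀ i j, i ≠ j → s i * t j - s j * t i ≠ 0) :
    minDist (conicCode s t) = n - 2 := by
  obtain ⟨i, j, k, hij, hik, hjk⟩ := exists_three_distinct hn
  refine minDist_eq_of_forall_le (mul_sub_mul_mem_conicCode s t j k)
    (fun h => mul_ne_zero (hst i j hij) (hst i k hik) (congrFun h i)) ?_ ?_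
  · set x : Fin n → K := fun i => (s i * t j - s j * t i) * (s i * t k - s k * t i)
    have h1 : ({j, k} : Finset (Fin n)) ⊆ ({i | x i = 0} : Finset (Fin n)) := by
      intro l hl
      rcases Finset.mem_insert.1 hl with rfl | hl
      · simp [x]
      · rw [Finset.mem_singleton.1 hl]
        simp [x]
    have h2 := Finset.card_le_card h1
    rw [Finset.card_pair hjk] at h2
    have h3 := hammingNorm_add_card_zeros x
    lia
  · rintro _ ⟨v, rfl⟩ hv
    rw [Matrix.mulVecLin_apply] at hv ⊢
    by_contra! hlt
    have h := hammingNorm_add_card_zeros ((Matrix.rectVandermonde s t 3).mulVec v)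
    obtain ⟨a, ha, b, hb, c, hc, hab, hac, hbc⟩ := Finset.two_lt_card.1
      (show 2 < #{i | (Matrix.rectVandermonde s t 3).mulVec v i = 0} by lia)
    rw [Finset.mem_filter] at ha hb hc
    refine hv ?_
    rw [eq_zero_of_rectVandermonde_mulVec_eq_zero hst hab hac hbc ha.2 hb.2 hc.2,
      Matrix.mulVec_zero]

lemma finrank_dualCode {K : Type*} [Field K] {n : ℕ} (C : Submodule K (Fin n → K)) :
    Module.finrank K (dualCode C) = n - Module.finrank K C := by
  have h : dualCode C = C.dualAnnihilator.comap (dotProductEquiv K (Fin n)).toLinearMap := by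
    ext x
    rw [Submodule.mem_comap, Submodule.mem_dualAnnihilator]
    rfl
  rw [h, Submodule.comap_equiv_eq_map_symm, LinearEquiv.finrank_map_eq]
  have h1 := Subspace.finrank_add_finrank_dualAnnihilator_eq C
  rw [Module.finrank_fin_fun] at h1
  lia

lemma eq_zero_of_mem_dualCode_conicCode {K : Type*} [Field K] {n : ℕ} {s t : Fin n → K}
    (hst : ∀ i j, i ≠ j → s i * t j - s j * t i ≠ 0) {x : Fin n → K}
    (hx : x ∈ dualCode (conicCode s t)) {i j k : Fin n} (hij : i ≠ j) (hik : i ≠ k)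
    (h : ∀ l, l ≠ i → l ≠ j → l ≠ k → x l = 0) : x i = 0 := by
  have h1 := hx _ (mul_sub_mul_mem_conicCode s t j k)
  rw [Finset.sum_eq_single i] at h1
  · exact (mul_eq_zero.1 h1).resolve_right (mul_ne_zero (hst i j hij) (hst i k hik))
  · intro l _ hli
    by_cases hlj : l = j
    · simp [hlj]
    by_cases hlk : l = k
    · simp [hlk]
    rw [h l hli hlj hlk, zero_mul]
  · simp

lemma minDist_dualCode_conicCode {K : Type*} [Field K] [DecidableEq K]
    {n : ℕ} (hn : 4 ≤ n) {s t : Fin n → K}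
    (hst : ∀ i j, i ≠ j → s i * t j - s j * t i ≠ 0) :
    minDist (dualCode (conicCode s t)) = 4 := by
  obtain ⟨i, j, k, l, hij, hik, hil, hjk, hjl, hkl⟩ : ∃ i j k l : Fin n,
      i ≠ j ∧ i ≠ k ∧ i ≠ l ∧ j ≠ k ∧ j ≠ l ∧ k ≠ l :=
    ⟨⟨0, by lia⟩, ⟨1, by lia⟩, ⟨2, by lia⟩, ⟨3, by lia⟩,
      by simp, by simp, by simp, by simp, by simp, by simp⟩
  let D : Fin n → Fin n → K := fun a b => s a * t b - s b * t a
  let x : Fin n → K := Pi.single i (D j k * D j l * D k l) - Pi.single j (D i k * D i l * D k l) +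
    Pi.single k (D i j * D i l * D j l) - Pi.single l (D i j * D i k * D j k)
  refine minDist_eq_of_forall_le (c := x) ?_ (fun h => ?_) ?_ ?_
  · intro c hc
    obtain ⟨a, b, e, hc⟩ := mem_conicCode_iff.1 hc
    simp only [x, Pi.add_apply, Pi.sub_apply, add_mul, sub_mul, Finset.sum_add_distrib,
      Finset.sum_sub_distrib, Pi.single_apply, ite_mul, zero_mul, Finset.sum_ite_eq',
      Finset.mem_univ, if_true, hc, D]
    ring
  · have hi := congrFun h i
    simp only [x, Pi.add_apply, Pi.sub_apply, Pi.single_eq_same, Pi.single_eq_of_ne hij,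
      Pi.single_eq_of_ne hik, Pi.single_eq_of_ne hil, sub_zero, add_zero, Pi.zero_apply] at hi
    exact mul_ne_zero (mul_ne_zero (hst j k hjk) (hst j l hjl)) (hst k l hkl) hi
  · have h1 : ({a | x a ≠ 0} : Finset (Fin n)) ⊆ {i, j, k, l} := by
      intro a ha
      by_contra hcon
      simp only [Finset.mem_insert, Finset.mem_singleton, not_or] at hcon
      obtain ⟨h1, h2, h3, h4⟩ := hcon
      simp [x, h1, h2, h3, h4] at ha
    exact (Finset.card_le_card h1).trans Finset.card_le_four
  · intro y hy hy0
    by_contra! hlt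
    obtain ⟨T, hT, hT3⟩ := Finset.exists_superset_card_eq
      (s := ({a | y a ≠ 0} : Finset (Fin n))) (n := 3)
      (Nat.le_of_lt_succ hlt) (by rw [Fintype.card_fin]; lia)
    obtain ⟨a, b, c, hab, hac, hbc, rfl⟩ := Finset.card_eq_three.1 hT3
    have hsupp : ∀ m, m ≠ a → m ≠ b → m ≠ c → y m = 0 := by
      intro m h1 h2 h3
      by_contra hm
      have := hT (Finset.mem_filter.2 ⟨Finset.mem_univ m, hm⟩)
      simp [h1, h2, h3] at this
    refine hy0 (funext fun m => ?_)
    by_cases h1 : m = a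
    · rw [h1]
      exact eq_zero_of_mem_dualCode_conicCode hst hy hab hac hsupp
    by_cases h2 : m = b
    · rw [h2]
      exact eq_zero_of_mem_dualCode_conicCode hst hy hab.symm hbc
        fun m h1 h2 h3 => hsupp m h2 h1 h3
    by_cases h3 : m = c
    · rw [h3]
      exact eq_zero_of_mem_dualCode_conicCode hst hy hac.symm hbc.symm
        fun m h1 h2 h3 => hsupp m h2 h3 h1
    exact hsupp m h1 h2 h3

lemma sum_inv_sq_mul_sq {K : Type*} [Field K] [Fintype K] :
    ∑ x : K, (x⁻¹) ^ 2 * x ^ 2 = -1 := by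
  classical
  have h : ∀ x : K, (x⁻¹) ^ 2 * x ^ 2 = 1 - if x = 0 then 1 else 0 := by
    intro x
    by_cases hx : x = 0
    · simp [hx]
    · rw [← mul_pow, inv_mul_cancel₀ hx]
      simp [hx]
  simp only [h, Finset.sum_sub_distrib]
  simp

lemma sum_inv_pow_eq_zero {K : Type*} [Field K] [Fintype K]
    {k : ℕ} (hk : k < Fintype.card K - 1) : ∑ x : K, (x⁻¹) ^ k = 0 := by
  rw [(inv_involutive (G := K)).bijective.sum_comp fun x => x ^ k]
  exact FiniteField.sum_pow_lt_card_sub_one K k hk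

lemma sum_inv_sq_mul_self {K : Type*} [Field K] [Fintype K]
    (hF : 3 < Fintype.card K) : ∑ x : K, (x⁻¹) ^ 2 * x = 0 := by
  rw [← sum_inv_pow_eq_zero (K := K) (k := 1) (by lia)]
  refine Finset.sum_congr rfl fun x _ => ?_
  by_cases hx : x = 0
  · simp [hx]
  · field_simp

/-- The affine points `(p i : 1)` together with the point at infinity are distinct. -/
lemma snoc_mul_snoc_sub_ne_zero {K : Type*} [Field K]
    {n : ℕ} {p : Fin n → K} (hp : Function.Injective p)
    (i j : Fin (n + 1)) (hij : i ≠ j) :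
    (Fin.snoc p 1 : Fin (n + 1) → K) i * (Fin.snoc (fun _ => 1) 0 : Fin (n + 1) → K) j -
      (Fin.snoc p 1 : Fin (n + 1) → K) j * (Fin.snoc (fun _ => 1) 0 : Fin (n + 1) → K) i ≠ 0 := by
  induction i using Fin.lastCases with
  | last =>
    induction j using Fin.lastCases with
    | last => exact absurd rfl hij
    | cast j => simp
  | cast i =>
    induction j using Fin.lastCases with
    | last => simp
    | cast j =>
      simp only [Fin.snoc_castSucc, mul_one]
      exact sub_ne_zero.2 fun h => hij (congrArg _ (hp h))

/-- Extending the code of quadratic polynomials on all of `K` by `-(x⁻¹) ^ 2` appends the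
leading coefficient. -/
lemma extCode_eq_conicCode {K : Type*} [Field K] [Fintype K]
    {n : ℕ} (hF : 3 < Fintype.card K) {p : Fin n → K}
    (hp : Function.Bijective p) {u : Fin n → K} (hu : ∀ j, u j = -((p j)⁻¹ ^ 2)) :
    extCode (Submodule.span K {fun j => p j ^ 2, p, fun _ => 1}) u =
      conicCode (Fin.snoc p 1) (Fin.snoc (fun _ => 1) 0) := by
  have hsum : ∀ a b c : K, ∑ j, u j * (a * p j ^ 2 + b * p j + c) = a := by
    intro a b c
    simp only [hu]
    rw [hp.sum_comp fun x => -(x⁻¹ ^ 2) * (a * x ^ 2 + b * x + c)]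
    calc ∑ x : K, -(x⁻¹ ^ 2) * (a * x ^ 2 + b * x + c)
        = -a * ∑ x : K, x⁻¹ ^ 2 * x ^ 2 - b * ∑ x : K, x⁻¹ ^ 2 * x - c * ∑ x : K, x⁻¹ ^ 2 := by
          simp only [Finset.mul_sum, ← Finset.sum_sub_distrib]
          exact Finset.sum_congr rfl fun x _ => by ring
      _ = a := by
          rw [sum_inv_sq_mul_sq, sum_inv_sq_mul_self hF, sum_inv_pow_eq_zero (by lia)]
          ring
  ext x
  rw [mem_conicCode_iff]
  simp only [Fin.forall_fin_succ', Fin.snoc_castSucc, Fin.snoc_last, mul_one, one_pow, mul_zero,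
    add_zero, ne_eq, OfNat.ofNat_ne_zero, not_false_eq_true, zero_pow]
  constructor
  · rintro ⟨hx, hlast⟩
    obtain ⟨a, b, c, h⟩ := Submodule.mem_span_triple.1 hx
    have h' : ∀ i : Fin n, x i.castSucc = a * p i ^ 2 + b * p i + c := by
      intro i
      simpa using (congrFun h i).symm
    refine ⟨a, b, c, h', ?_⟩
    simp only [hlast, h', hsum]
  · rintro ⟨a, b, c, h', hlast⟩
    refine ⟨Submodule.mem_span_triple.2 ⟨a, b, c, ?_⟩, ?_⟩
    · ext i
      simp [h']
    · simp only [hlast, h', hsum]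

lemma const_mem_dualCode {K : Type*} [Field K] [Fintype K]
    {n : ℕ} (hF : 3 < Fintype.card K) {p : Fin n → K}
    (hp : Function.Bijective p) (r : K) :
    (fun _ => r) ∈ dualCode (Submodule.span K {fun j => p j ^ 2, p, fun _ => 1}) := by
  intro c hc
  obtain ⟨a, b, e, rfl⟩ := Submodule.mem_span_triple.1 hc
  have hpow : ∀ k < 3, ∑ j, p j ^ k = 0 := fun k hk => by
    rw [hp.sum_comp fun x => x ^ k]
    exact FiniteField.sum_pow_lt_card_sub_one K k (by lia)
  calc ∑ j, r * (a • (fun j => p j ^ 2) + b • p + e • fun _ => 1 : Fin n → K) j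
      = r * (a * ∑ j, p j ^ 2 + b * ∑ j, p j ^ 1 + e * ∑ j, p j ^ 0) := by
        simp only [Finset.mul_sum, ← Finset.sum_add_distrib]
        exact Finset.sum_congr rfl fun j _ => by simp
    _ = 0 := by
        rw [hpow 2 (by lia), hpow 1 (by lia), hpow 0 (by lia)]
        ring

/-- Zero followed by the powers of a primitive element enumerates the field. -/
lemma bijective_zero_pow {K : Type*} [Field K] [Fintype K] {q : ℕ} (hF : Fintype.card K = q) {α : K}
    (hα : IsPrimitiveRoot α (q - 1)) (hα0 : α ≠ 0) :
    Function.Bijective fun j : Fin q => if (j : ℕ) = 0 then (0 : K) else α ^ ((j : ℕ) - 1) := by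
  refine (Fintype.bijective_iff_injective_and_card _).2 ⟨fun i j hij => ?_, by simp [hF]⟩
  have hi := i.2
  have hj := j.2
  ext
  by_cases h1 : (i : ℕ) = 0 <;> by_cases h2 : (j : ℕ) = 0 <;>
    simp only [h1, h2, if_true, if_false] at hij ⊢
  · exact absurd hij.symm (pow_ne_zero _ hα0)
  · exact absurd hij (pow_ne_zero _ hα0)
  · have := hα.pow_inj (by lia) (by lia) hij
    lia

/-- for the `[q,3,q-2]` code `Cα` spanned by the rows of `G_α`, the
all-one vector lies in `Cα^⊥` (so the standardly extended code is trivial), while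
the extension by `u⁽¹⁾ = -(0,1,α⁻²,…,α^{-2(q-2)})` is a `[q+1,3,q-1]` code with
dual of parameters `[q+1,q-2,4]`. -/
theorem stmt6 {F : Type*} [Field F] [Fintype F] [DecidableEq F] (q : ℕ)
    (hF : Fintype.card F = q) (hq : 3 < q)
    (α : F) (hα : IsPrimitiveRoot α (q - 1))
    (r0 r1 r2 : Fin q → F)
    (h0 : ∀ j, r0 j = if (j : ℕ) = 0 then 0 else α ^ (2 * ((j : ℕ) - 1)))
    (h1 : ∀ j, r1 j = if (j : ℕ) = 0 then 0 else α ^ ((j : ℕ) - 1))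
    (h2 : ∀ j, r2 j = 1)
    (Cα : Submodule F (Fin q → F)) (hCα : Cα = Submodule.span F {r0, r1, r2})
    (u : Fin q → F)
    (hu : ∀ j, u j = if (j : ℕ) = 0 then 0 else -((α ^ (2 * ((j : ℕ) - 1)))⁻¹)) :
    (fun _ => (-1 : F)) ∈ dualCode Cα ∧
    Module.finrank F (extCode Cα u) = 3 ∧
    minDist (extCode Cα u) = q - 1 ∧
    Module.finrank F (dualCode (extCode Cα u)) = q - 2 ∧
    minDist (dualCode (extCode Cα u)) = 4 := by
  have hp : Function.Bijective r1 := by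
    rw [funext h1]
    exact bijective_zero_pow hF hα (hα.ne_zero (by lia))
  have hr0 : r0 = fun j => r1 j ^ 2 := by
    ext j
    rw [h0, h1]
    split_ifs
    · simp
    · rw [mul_comm, pow_mul]
  have hr2 : r2 = fun _ => 1 := funext h2
  have hur : ∀ j, u j = -((r1 j)⁻¹ ^ 2) := by
    intro j
    rw [hu, h1]
    split_ifs
    · simp
    · rw [mul_comm, pow_mul, inv_pow]
  have hcard : 3 < Fintype.card F := hF ▸ hq
  have hst := snoc_mul_snoc_sub_ne_zero hp.injective
  subst hCα hr0 hr2
  refine ⟨const_mem_dualCode hcard hp _, ?_⟩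
  rw [extCode_eq_conicCode hcard hp hur, finrank_dualCode, finrank_conicCode (by lia) hst,
    minDist_conicCode (by lia) hst, minDist_dualCode_conicCode (by lia) hst]
  lia
end

section
/- Let q ≥ 5 be an odd prime power. The triply extended conic code — the [q+3, 3] code with generator matrix having columns (0,0,1)^T, (α^{2i}, α^i, 1)^T for 0 ≤ i ≤ q-2, (1,0,0)^T, (0,1,0)^T, and (-1,-1,0)^T — has minimum distance q, its dual has parameters [q+3, q, 3], and its weight enumerator is 1 + q(q-1)z^q + ((q^3 - 2q^2 + 7q - 6)/2) z^{q+1} + (2q^2 - 5q + 3) z^{q+2} + ((q-2)(q-1)^2/2) z^{q+3}. -/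
open Finset

variable {F : Type*} [Field F] [Fintype F] [DecidableEq F]

/-- The coordinates of the codeword with coefficients `a, b, c`, indexed by the affine points of the
conic together with the three points at infinity. -/
def conicEval (a b c : F) : F ⊕ Fin 3 → F :=
  Sum.elim (fun x => a * x ^ 2 + b * x + c) ![a, b, -(a + b)]

/-- The number of nonzero coordinates among the three points at infinity. -/
def infWeight (a b : F) : ℕ :=
  (if a = 0 then 0 else 1) + (if b = 0 then 0 else 1) + (if a + b = 0 then 0 else 1)

/-- The number of nonzero coordinates among the affine points of the conic. -/
def affWeight (a b c : F) : ℕ := #{x : F | a * x ^ 2 + b * x + c ≠ 0}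

lemma card_conicEval_ne_zero (a b c : F) :
    #{s : F ⊕ Fin 3 | conicEval a b c s ≠ 0} = affWeight a b c + infWeight a b := by
  rw [affWeight, infWeight, Finset.card_filter, Fintype.sum_sum_type, Fin.sum_univ_three,
    Finset.card_filter]
  have h : -b + -a = 0 ↔ a + b = 0 := by rw [← neg_add_rev, neg_eq_zero]
  simp [conicEval, h]

lemma card_sqrt_le_two (d : F) : #{y : F | y ^ 2 = d} ≤ 2 := by
  by_cases h : ∃ y, y ^ 2 = d
  · obtain ⟨y, rfl⟩ := h
    refine (Finset.card_le_card (t := {y, -y}) ?_).trans Finset.card_le_two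
    intro z hz
    simpa [sq_eq_sq_iff_eq_or_eq_neg] using hz
  · push Not at h
    simp [h]

lemma card_sqrt_eq_one_iff (h2 : (2 : F) ≠ 0) (d : F) : #{y : F | y ^ 2 = d} = 1 ↔ d = 0 := by
  constructor
  · intro h
    obtain ⟨y, hy⟩ := Finset.card_eq_one.1 h
    have h1 : y ^ 2 = d := by
      have : y ∈ ({y : F | y ^ 2 = d} : Finset F) := by rw [hy]; simp
      simpa using this
    have h3 : -y ∈ ({y : F | y ^ 2 = d} : Finset F) := by simp [h1]
    rw [hy, Finset.mem_singleton] at h3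
    have h4 : 2 * y = 0 := by linear_combination -h3
    have : y = 0 := by simpa [h2] using h4
    simp [← h1, this]
  · rintro rfl
    simp [Finset.filter_eq']

lemma card_card_sqrt_eq (h2 : (2 : F) ≠ 0) :
    #{d : F | #{y : F | y ^ 2 = d} = 1} = 1 ∧
    2 * #{d : F | #{y : F | y ^ 2 = d} = 2} + 1 = Fintype.card F ∧
    2 * #{d : F | #{y : F | y ^ 2 = d} = 0} + 1 = Fintype.card F := by
  have hone : #{d : F | #{y : F | y ^ 2 = d} = 1} = 1 := by
    simp [card_sqrt_eq_one_iff h2, Finset.filter_eq']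
  have hsum : ∑ d : F, #{y : F | y ^ 2 = d} = Fintype.card F :=
    (Finset.card_eq_sum_card_fiberwise (fun _ _ => by simp)).symm
  have hweighted : ∑ d : F, #{y : F | y ^ 2 = d} =
      #{d : F | #{y : F | y ^ 2 = d} = 1} + 2 * #{d : F | #{y : F | y ^ 2 = d} = 2} := by
    rw [Finset.card_filter, Finset.card_filter, Finset.mul_sum, ← Finset.sum_add_distrib]
    refine Finset.sum_congr rfl fun d _ => ?_
    have := card_sqrt_le_two d
    split_ifs <;> omega
  have hcard : Fintype.card F = #{d : F | #{y : F | y ^ 2 = d} = 0} +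
      #{d : F | #{y : F | y ^ 2 = d} = 1} + #{d : F | #{y : F | y ^ 2 = d} = 2} := by
    rw [← Finset.card_univ, Finset.card_eq_sum_ones]
    simp only [Finset.card_filter (fun d : F => #{y : F | y ^ 2 = d} = _), ←
      Finset.sum_add_distrib]
    refine Finset.sum_congr rfl fun d _ => ?_
    have := card_sqrt_le_two d
    split_ifs <;> omega
  omega

lemma affWeight_add_card_sqrt (h2 : (2 : F) ≠ 0) {a : F} (ha : a ≠ 0) (b c : F) :
    affWeight a b c + #{y : F | y ^ 2 = b ^ 2 / (4 * a ^ 2) - c / a} = Fintype.card F := by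
  have h4 : (4 : F) ≠ 0 := by
    have := mul_ne_zero h2 h2
    norm_num at this
    exact this
  have key : #{y : F | y ^ 2 = b ^ 2 / (4 * a ^ 2) - c / a} =
      #{x : F | a * x ^ 2 + b * x + c = 0} := by
    refine (Finset.card_equiv (Equiv.addRight (b / (2 * a))) fun x => ?_).symm
    have : (x + b / (2 * a)) ^ 2 - (b ^ 2 / (4 * a ^ 2) - c / a) =
        (a * x ^ 2 + b * x + c) / a := by
      field_simp
      ring
    simp only [Finset.mem_filter, Finset.mem_univ, true_and, Equiv.coe_addRight]
    rw [← sub_eq_zero (a := (x + b / (2 * a)) ^ 2), this]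
    simp [ha]
  rw [key, affWeight, add_comm]
  exact Finset.card_filter_add_card_filter_not _

/-- The number of constant terms for which the quadratic codeword has weight `w`. -/
def fiberCount (w : ℕ) (a b : F) : ℕ := #{c : F | affWeight a b c + infWeight a b = w}

lemma fiberCount_of_ne_zero (h2 : (2 : F) ≠ 0) {a : F} (ha : a ≠ 0) (b : F) (w : ℕ) :
    fiberCount w a b = #{d : F | #{y : F | y ^ 2 = d} + w = Fintype.card F + infWeight a b} := by
  have hbij : Function.Bijective fun c : F => b ^ 2 / (4 * a ^ 2) - c / a :=
    Finite.injective_iff_bijective.1 fun c c' h => by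
      simpa [ha, div_left_inj'] using h
  refine Finset.card_equiv (Equiv.ofBijective _ hbij) fun c => ?_
  have := affWeight_add_card_sqrt h2 ha b c
  simp only [Finset.mem_filter, Finset.mem_univ, true_and, Equiv.ofBijective_apply]
  omega

lemma affWeight_zero_left {b : F} (hb : b ≠ 0) (c : F) :
    affWeight 0 b c = Fintype.card F - 1 := by
  have : ({x : F | (0 : F) * x ^ 2 + b * x + c ≠ 0} : Finset F) = {-c / b}ᶜ := by
    ext x
    simp only [Finset.mem_filter, Finset.mem_univ, true_and, Finset.mem_compl,
      Finset.mem_singleton, ne_eq, not_iff_not, eq_div_iff hb]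
    constructor <;> intro h <;> linear_combination h
  rw [affWeight, this, Finset.card_compl, Finset.card_singleton]

lemma affWeight_zero_zero (c : F) :
    affWeight 0 0 c = if c = 0 then 0 else Fintype.card F := by
  split_ifs with h <;> simp [affWeight, h]

omit [DecidableEq F] in
lemma sum_eq_of_orbits (f : F → F → ℕ) {A X Y Z : ℕ} (hA : f 0 0 = A)
    (hX : ∀ b ≠ 0, f 0 b = X) (hY : ∀ a ≠ 0, f a 0 = Y) (hY' : ∀ a ≠ 0, f a (-a) = Y)
    (hZ : ∀ a ≠ 0, ∀ b ≠ 0, a + b ≠ 0 → f a b = Z) :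
    ∑ a, ∑ b, f a b = A + (Fintype.card F - 1) * X +
      (Fintype.card F - 1) * (2 * Y + (Fintype.card F - 2) * Z) := by
  classical
  rw [← Finset.add_sum_erase _ _ (Finset.mem_univ 0),
    ← Finset.add_sum_erase _ (f 0) (Finset.mem_univ 0), hA,
    Finset.sum_congr (g := fun _ => X) rfl fun b hb => hX b (Finset.ne_of_mem_erase hb),
    Finset.sum_congr (s₁ := Finset.univ.erase 0) (f := fun a => ∑ b, f a b)
      (g := fun _ => 2 * Y + (Fintype.card F - 2) * Z) rfl fun a ha => ?_]
  · simp [Finset.card_erase_of_mem]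
  have ha := Finset.ne_of_mem_erase ha
  have hna : -a ∈ Finset.univ.erase (0 : F) := by simp [ha]
  rw [← Finset.add_sum_erase _ _ (Finset.mem_univ 0), ← Finset.add_sum_erase _ _ hna,
    hY a ha, hY' a ha, Finset.sum_congr rfl fun b hb => hZ a ha b
      (Finset.ne_of_mem_erase (Finset.mem_of_mem_erase hb)) fun h =>
        Finset.ne_of_mem_erase hb (eq_neg_of_add_eq_zero_right h),
    Finset.sum_const, Finset.card_erase_of_mem hna, Finset.card_erase_of_mem (Finset.mem_univ _),
    Finset.card_univ, smul_eq_mul, Nat.sub_sub]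
  ring

lemma sum_fiberCount (h2 : (2 : F) ≠ 0) (w : ℕ) :
    ∑ a : F, ∑ b : F, fiberCount w a b =
      #{c : F | (if c = 0 then 0 else Fintype.card F) = w} +
      (Fintype.card F - 1) * (if Fintype.card F + 1 = w then Fintype.card F else 0) +
      (Fintype.card F - 1) * (2 * #{d : F | #{y : F | y ^ 2 = d} + w = Fintype.card F + 2} +
        (Fintype.card F - 2) * #{d : F | #{y : F | y ^ 2 = d} + w = Fintype.card F + 3}) := by
  refine sum_eq_of_orbits _ ?_ ?_ ?_ ?_ ?_
  · simp [fiberCount, affWeight_zero_zero, infWeight]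
  · intro b hb
    have : 0 < Fintype.card F := Fintype.card_pos
    have h : Fintype.card F - 1 + 2 = Fintype.card F + 1 := by omega
    simp only [fiberCount, affWeight_zero_left hb, infWeight, hb, zero_add, if_true, if_false,
      Nat.reduceAdd, h]
    split_ifs with h <;> simp [h]
  · intro a ha
    simp [fiberCount_of_ne_zero h2 ha, infWeight, ha]
  · intro a ha
    simp [fiberCount_of_ne_zero h2 ha, infWeight, ha]
  · intro a ha b hb hab
    simp [fiberCount_of_ne_zero h2 ha, infWeight, ha, hb, hab]

omit [DecidableEq F] in
lemma exists_conic_equiv {q : ℕ} (hF : Fintype.card F = q) (hq : 5 ≤ q)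
    {α : F} (hα : IsPrimitiveRoot α (q - 1)) :
    ∃ e : F ≃ Fin q, ∀ x, x = if (e x : ℕ) = 0 then 0 else α ^ ((e x : ℕ) - 1) := by
  have hα0 : α ≠ 0 := hα.ne_zero (by omega)
  let g : Fin q → F := fun j => if (j : ℕ) = 0 then 0 else α ^ ((j : ℕ) - 1)
  have hg : Function.Injective g := by
    intro i j hij
    simp only [g] at hij
    ext
    split_ifs at hij with hi hj hj
    · omega
    · exact absurd hij.symm (pow_ne_zero _ hα0)
    · exact absurd hij (pow_ne_zero _ hα0)
    · have := hα.pow_inj (by omega) (by omega) hij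
      omega
  have hb : Function.Bijective g :=
    (Fintype.bijective_iff_injective_and_card g).2 ⟨hg, by simp [hF]⟩
  exact ⟨(Equiv.ofBijective g hb).symm, fun x => ((Equiv.ofBijective g hb).apply_symm_apply x).symm⟩

omit [Fintype F] [DecidableEq F] in
lemma exists_conicEval_ne_zero_eq_zero {s t : F ⊕ Fin 3} (hst : s ≠ t) :
    ∃ a b c : F, conicEval a b c s ≠ 0 ∧ conicEval a b c t = 0 := by
  rcases s with s | k <;> rcases t with t | l
  · exact ⟨0, 1, -t, by simpa [conicEval, ← sub_eq_add_neg, sub_eq_zero] using hst,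
      by simp [conicEval]⟩
  · exact ⟨0, 0, 1, by simp [conicEval], by fin_cases l <;> simp [conicEval]⟩
  · fin_cases k
    · exact ⟨1, 0, -t ^ 2, by simp [conicEval], by simp [conicEval]⟩
    · exact ⟨0, 1, -t, by simp [conicEval], by simp [conicEval]⟩
    · exact ⟨0, 1, -t, by simp [conicEval], by simp [conicEval]⟩
  · have hkl : k ≠ l := fun h => hst (congrArg _ h)
    match k, l with
    | 0, 0 | 1, 1 | 2, 2 => exact absurd rfl hkl
    | 0, 1 | 2, 1 => exact ⟨1, 0, 0, by simp [conicEval], by simp [conicEval]⟩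
    | 1, 0 | 2, 0 => exact ⟨0, 1, 0, by simp [conicEval], by simp [conicEval]⟩
    | 0, 2 | 1, 2 => exact ⟨1, -1, 0, by simp [conicEval], by simp [conicEval]⟩

/-- The encoder of the code with generator rows `r0, r1, r2`. -/
def encoder {n : ℕ} (r0 r1 r2 : Fin n → F) : (F × F × F) →ₗ[F] (Fin n → F) where
  toFun p := p.1 • r0 + p.2.1 • r1 + p.2.2 • r2
  map_add' p p' := by
    simp only [Prod.fst_add, Prod.snd_add, add_smul]
    abel
  map_smul' t p := by simp [mul_smul]

/-- The parity checks attached to the rows `r0, r1, r2`. -/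
def parityChecks {n : ℕ} (r0 r1 r2 : Fin n → F) : (Fin n → F) →ₗ[F] (F × F × F) where
  toFun x := (∑ i, x i * r0 i, ∑ i, x i * r1 i, ∑ i, x i * r2 i)
  map_add' x y := by simp [add_mul, Finset.sum_add_distrib]
  map_smul' t x := by simp [mul_assoc, Finset.mul_sum]

/-- Up to the ordering `e` of the coordinates, `r0, r1, r2` are the rows of the generator matrix of
the triply extended conic code. -/
def IsConicRows {n : ℕ} (r0 r1 r2 : Fin n → F) (e : F ⊕ Fin 3 ≃ Fin n) : Prop :=
  ∀ a b c s, encoder r0 r1 r2 (a, b, c) (e s) = conicEval a b c s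

section rows

variable {n : ℕ} {r0 r1 r2 : Fin n → F} {e : F ⊕ Fin 3 ≃ Fin n}

omit [Fintype F] [DecidableEq F] in
lemma range_encoder : LinearMap.range (encoder r0 r1 r2) = Submodule.span F {r0, r1, r2} := by
  ext x
  simp [Submodule.mem_span_triple, encoder]

omit [Fintype F] [DecidableEq F] in
lemma IsConicRows.encoder_injective (he : IsConicRows r0 r1 r2 e) :
    Function.Injective (encoder r0 r1 r2) := by
  rw [injective_iff_map_eq_zero]
  rintro ⟨a, b, c⟩ h
  have key : ∀ s, conicEval a b c s = 0 := fun s => by rw [← he, h]; rfl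
  have ha := key (.inr 0)
  have hb := key (.inr 1)
  have hc := key (.inl 0)
  simp [conicEval] at ha hb hc
  simp [ha, hb, hc]

omit [Fintype F] [DecidableEq F] in
lemma IsConicRows.finrank_span (he : IsConicRows r0 r1 r2 e) :
    Module.finrank F (Submodule.span F {r0, r1, r2}) = 3 := by
  rw [← range_encoder, LinearMap.finrank_range_of_inj he.encoder_injective]
  simp

lemma IsConicRows.hammingNorm_encoder (he : IsConicRows r0 r1 r2 e) (a b c : F) :
    hammingNorm (encoder r0 r1 r2 (a, b, c)) = affWeight a b c + infWeight a b := by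
  rw [← card_conicEval_ne_zero]
  exact (Finset.card_equiv e fun s => by simp [← he a b c s]).symm

lemma IsConicRows.weightCount_span (he : IsConicRows r0 r1 r2 e) (w : ℕ) :
    weightCount (Submodule.span F {r0, r1, r2}) w = ∑ a : F, ∑ b : F, fiberCount w a b := by
  let E := (LinearEquiv.ofInjective _ he.encoder_injective).toEquiv
  rw [← range_encoder, weightCount, ← Nat.card_congr (E.subtypeEquiv
    (p := fun p => hammingNorm (E p : Fin n → F) = w) fun _ => Iff.rfl), Nat.card_eq_fintype_card,
    Fintype.card_subtype, Finset.card_filter, Fintype.sum_prod_type]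
  refine Finset.sum_congr rfl fun a _ => ?_
  rw [Fintype.sum_prod_type]
  refine Finset.sum_congr rfl fun b _ => ?_
  rw [fiberCount, Finset.card_filter]
  refine Finset.sum_congr rfl fun c _ => ?_
  rw [← he.hammingNorm_encoder]
  rfl

omit [Fintype F] [DecidableEq F] in
lemma dualCode_span :
    dualCode (Submodule.span F {r0, r1, r2}) = LinearMap.ker (parityChecks r0 r1 r2) := by
  ext x
  simp only [LinearMap.mem_ker, parityChecks, LinearMap.coe_mk, AddHom.coe_mk, Prod.mk_eq_zero]
  constructor
  · intro h
    exact ⟨h _ (Submodule.subset_span (by simp)), h _ (Submodule.subset_span (by simp)),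
      h _ (Submodule.subset_span (by simp))⟩
  · rintro ⟨h0, h1, h2⟩ c hc
    obtain ⟨a, b, d, rfl⟩ := Submodule.mem_span_triple.1 hc
    simp only [Pi.add_apply, Pi.smul_apply, smul_eq_mul, mul_add, Finset.sum_add_distrib,
      mul_left_comm _ a, mul_left_comm _ b, mul_left_comm _ d, ← Finset.mul_sum, h0, h1, h2,
      mul_zero, add_zero]

omit [Fintype F] [DecidableEq F] in
lemma IsConicRows.rows_apply (he : IsConicRows r0 r1 r2 e) (s : F ⊕ Fin 3) :
    r0 (e s) = conicEval 1 0 0 s ∧ r1 (e s) = conicEval 0 1 0 s ∧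
      r2 (e s) = conicEval 0 0 1 s := by
  simp [← he _ _ _ s, encoder]

omit [Fintype F] [DecidableEq F] in
lemma IsConicRows.parityChecks_surjective (he : IsConicRows r0 r1 r2 e) :
    Function.Surjective (parityChecks r0 r1 r2) := by
  rintro ⟨a, b, c⟩
  refine ⟨Pi.single (e (.inr 0)) a + Pi.single (e (.inr 1)) b + Pi.single (e (.inl 0)) c, ?_⟩
  simp [parityChecks, add_mul, Finset.sum_add_distrib, Pi.single_apply, he.rows_apply, conicEval]

omit [Fintype F] [DecidableEq F] in
lemma IsConicRows.finrank_dualCode (he : IsConicRows r0 r1 r2 e) :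
    Module.finrank F (dualCode (Submodule.span F {r0, r1, r2})) + 3 = n := by
  have h := (parityChecks r0 r1 r2).finrank_range_add_finrank_ker
  rw [LinearMap.range_eq_top.2 he.parityChecks_surjective, ← dualCode_span] at h
  simp at h
  omega

lemma IsConicRows.minDist_dualCode (he : IsConicRows r0 r1 r2 e) :
    minDist (dualCode (Submodule.span F {r0, r1, r2})) = 3 := by
  refine IsLeast.csInf_eq ⟨?_, ?_⟩
  · let x : Fin n → F := fun i => Sum.elim (fun _ => (0 : F)) (fun _ => 1) (e.symm i)
    have hx : ∀ s, x (e s) = Sum.elim (fun _ => (0 : F)) (fun _ => 1) s := fun s => by simp [x]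
    have hnorm : hammingNorm x = 3 := by
      have : hammingNorm x =
          #{s : F ⊕ Fin 3 | Sum.elim (fun _ => (0 : F)) (fun _ => 1) s ≠ 0} :=
        (Finset.card_equiv e fun s => by simp [hx]).symm
      rw [this, Finset.card_filter, Fintype.sum_sum_type]
      simp
    refine ⟨x, ?_, ?_, hnorm⟩
    · rw [dualCode_span, LinearMap.mem_ker]
      simp only [parityChecks, LinearMap.coe_mk, AddHom.coe_mk, ← e.sum_comp, hx, he.rows_apply,
        Fintype.sum_sum_type, Fin.sum_univ_three]
      simp [conicEval]
    · rintro h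
      simp [h] at hnorm
  · rintro w ⟨x, hx, hx0, rfl⟩
    by_contra! hlt
    obtain ⟨i, hi⟩ := Function.ne_iff.1 hx0
    have herase : #(({k | x k ≠ 0} : Finset (Fin n)).erase i) ≤ 1 := by
      rw [Finset.card_erase_of_mem (by simpa using hi)]
      have : #({k | x k ≠ 0} : Finset (Fin n)) < 3 := hlt
      omega
    obtain ⟨j, hji, hj⟩ : ∃ j, j ≠ i ∧ ∀ k, k ≠ i → k ≠ j → x k = 0 := by
      rcases Finset.eq_empty_or_nonempty (({k | x k ≠ 0} : Finset (Fin n)).erase i) with h | h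
      · have : Nontrivial (F ⊕ Fin 3) := Sum.inr_injective.nontrivial
        obtain ⟨s, hs⟩ := exists_ne (e.symm i)
        refine ⟨e s, fun h' => hs (by simp [← h']), fun k hki _ => ?_⟩
        by_contra hk
        exact Finset.notMem_empty k (h ▸ by simp [hki, hk])
      · obtain ⟨j, hj⟩ := h
        refine ⟨j, Finset.ne_of_mem_erase hj, fun k hki hkj => ?_⟩
        by_contra hk
        exact hkj (Finset.card_le_one.1 herase k (by simp [hki, hk]) j hj)
    obtain ⟨a, b, c, hne, hz⟩ := exists_conicEval_ne_zero_eq_zero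
      (s := e.symm i) (t := e.symm j) (by simpa using hji.symm)
    rw [← he, Equiv.apply_symm_apply] at hne hz
    have hsum := hx (encoder r0 r1 r2 (a, b, c)) (by rw [← range_encoder]; exact ⟨_, rfl⟩)
    rw [Finset.sum_eq_single i (fun k _ hk => ?_) (by simp)] at hsum
    · exact (mul_ne_zero hi hne) hsum
    · rcases eq_or_ne k j with rfl | hkj
      · rw [hz, mul_zero]
      · rw [hj k hk hkj, zero_mul]

end rows

lemma card_sqrt_add_eq (h2 : (2 : F) ≠ 0) {k : ℕ} (hk : Fintype.card F = 2 * k + 1) (w m : ℕ) :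
    #{d : F | #{y : F | y ^ 2 = d} + w = m} =
      if m = w ∨ m = w + 2 then k else if m = w + 1 then 1 else 0 := by
  obtain ⟨h1, h2, h0⟩ := card_card_sqrt_eq h2
  split_ifs with h h'
  · rcases h with rfl | rfl
    · simp only [Nat.add_eq_right]
      omega
    · simp only [add_comm w, Nat.add_right_cancel_iff]
      omega
  · simp only [h', add_comm w, Nat.add_right_cancel_iff]
    exact h1
  · rw [Finset.card_eq_zero, Finset.filter_eq_empty_iff]
    intro d _
    have := card_sqrt_le_two d
    omega

lemma card_ite_zero_eq {m : ℕ} (hm : m ≠ 0) (hF : Fintype.card F = m) (w : ℕ) :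
    #{c : F | (if c = 0 then 0 else m) = w} = if w = 0 then 1 else if w = m then m - 1 else 0 := by
  split_ifs with h h'
  · simp [h, hm, Finset.filter_eq']
  · subst h'
    have : ({c : F | (if c = 0 then 0 else w) = w} : Finset F) = {0}ᶜ := by
      ext c
      by_cases hc : c = 0 <;> simp [hc, hm.symm]
    rw [this, Finset.card_compl, Finset.card_singleton, hF]
  · rw [Finset.card_eq_zero, Finset.filter_eq_empty_iff]
    intro c _
    split_ifs <;> omega

/-- the triply extended conic code over `GF(q)`, `q ≥ 5` odd, has
parameters `[q+3,3,q]`, dual parameters `[q+3,q,3]` and the stated weight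
enumerator. -/
theorem stmt7 {F : Type*} [Field F] [Fintype F] [DecidableEq F] (q : ℕ)
    (hF : Fintype.card F = q) (hq : 5 ≤ q) (hodd : Odd q)
    (α : F) (hα : IsPrimitiveRoot α (q - 1))
    (r0 r1 r2 : Fin (q + 3) → F)
    (h0 : ∀ j, r0 j = if (j : ℕ) = 0 then 0
      else if (j : ℕ) ≤ q - 1 then α ^ (2 * ((j : ℕ) - 1))
      else if (j : ℕ) = q then 1
      else if (j : ℕ) = q + 1 then 0 else -1)
    (h1 : ∀ j, r1 j = if (j : ℕ) = 0 then 0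
      else if (j : ℕ) ≤ q - 1 then α ^ ((j : ℕ) - 1)
      else if (j : ℕ) = q then 0
      else if (j : ℕ) = q + 1 then 1 else -1)
    (h2 : ∀ j, r2 j = if (j : ℕ) ≤ q - 1 then 1 else 0)
    (C : Submodule F (Fin (q + 3) → F)) (hC : C = Submodule.span F {r0, r1, r2}) :
    Module.finrank F C = 3 ∧
    minDist C = q ∧
    Module.finrank F (dualCode C) = q ∧
    minDist (dualCode C) = 3 ∧
    weightCount C 0 = 1 ∧
    (weightCount C q : ℤ) = q * (q - 1) ∧
    2 * (weightCount C (q + 1) : ℤ) = q ^ 3 - 2 * q ^ 2 + 7 * q - 6 ∧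
    (weightCount C (q + 2) : ℤ) = 2 * q ^ 2 - 5 * q + 3 ∧
    2 * (weightCount C (q + 3) : ℤ) = (q - 2) * (q - 1) ^ 2 ∧
    (∀ w : ℕ, w ∉ ({0, q, q + 1, q + 2, q + 3} : Set ℕ) → weightCount C w = 0) := by
  have h2' : (2 : F) ≠ 0 := by
    refine Ring.two_ne_zero fun h => ?_
    have := FiniteField.even_card_of_char_two h
    rw [hF] at this
    exact Nat.not_even_iff_odd.2 hodd (Nat.even_iff.2 this)
  obtain ⟨g, hg⟩ := exists_conic_equiv hF hq hα
  let e : F ⊕ Fin 3 ≃ Fin (q + 3) := (g.sumCongr (Equiv.refl _)).trans finSumFinEquiv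
  have hel : ∀ x, (e (.inl x) : ℕ) = g x := fun x => by simp [e]
  have her : ∀ k, (e (.inr k) : ℕ) = q + k := fun k => by simp [e]
  have he : IsConicRows r0 r1 r2 e := by
    rintro a b c (x | k)
    · have hlt : (g x : ℕ) ≤ q - 1 := by have := (g x).2; omega
      have hx := hg x
      simp only [encoder, LinearMap.coe_mk, AddHom.coe_mk, Pi.add_apply, Pi.smul_apply, smul_eq_mul,
        h0, h1, h2, hel, hlt, if_true, conicEval, Sum.elim_inl]
      split_ifs at hx ⊢ with hgx
      · simp [hx]
      · rw [mul_comm 2, pow_mul, ← hx, mul_one]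
    · have hk : ∀ l : ℕ, ¬ q + l ≤ q - 1 := fun l => by omega
      have hk0 : ∀ l : ℕ, ¬ q + l = 0 := fun l => by omega
      simp only [encoder, LinearMap.coe_mk, AddHom.coe_mk, Pi.add_apply, Pi.smul_apply, smul_eq_mul,
        h0, h1, h2, her, hk, hk0, if_false, conicEval, Sum.elim_inr]
      fin_cases k <;> simp
      ring
  obtain ⟨k, hk⟩ := hodd
  obtain ⟨m, rfl⟩ : ∃ m, k = m + 2 := ⟨k - 2, by omega⟩
  have hcount : ∀ w, weightCount C w =
      (if w = 0 then 1 else if w = q then q - 1 else 0) +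
      (q - 1) * (if q + 1 = w then q else 0) +
      (q - 1) * (2 * (if q + 2 = w ∨ q + 2 = w + 2 then m + 2 else if q + 2 = w + 1 then 1 else 0) +
        (q - 2) * (if q + 3 = w ∨ q + 3 = w + 2 then m + 2 else
          if q + 3 = w + 1 then 1 else 0)) := fun w => by
    rw [hC, he.weightCount_span, sum_fiberCount h2', hF, card_ite_zero_eq (by omega) hF,
      card_sqrt_add_eq h2' (hF.trans hk), card_sqrt_add_eq h2' (hF.trans hk)]
  have hzero : ∀ w : ℕ, w ∉ ({0, q, q + 1, q + 2, q + 3} : Set ℕ) → weightCount C w = 0 := by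
    intro w hw
    simp only [Set.mem_insert_iff, Set.mem_singleton_iff, not_or] at hw
    rw [hcount, if_neg hw.1, if_neg hw.2.1, if_neg (by omega), if_neg (by omega),
      if_neg (by omega), if_neg (by omega), if_neg (by omega)]
    simp
  have hq1 : q - 1 = 2 * m + 4 := by omega
  have hq2 : q - 2 = 2 * m + 3 := by omega
  have hwq : weightCount C q = q * (q - 1) := by
    rw [hcount, if_neg (by omega), if_pos rfl, if_neg (by omega), if_pos (by omega),
      if_neg (by omega), if_neg (by omega), hq1, hk]
    ring
  have hmin : minDist C = q := by
    refine IsLeast.csInf_eq ⟨?_, ?_⟩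
    · have hpos : weightCount C q ≠ 0 := by
        rw [hwq]
        exact Nat.mul_ne_zero (by omega) (by omega)
      obtain ⟨⟨⟨c, hc⟩, hcq⟩⟩ := (Nat.card_ne_zero.1 hpos).1
      refine ⟨c, hc, ?_, hcq⟩
      rintro rfl
      simp at hcq
      omega
    · rintro w ⟨c, hc, hc0, rfl⟩
      by_contra! hlt
      have hc1 : hammingNorm c ≠ 0 := by simpa using hc0
      have hw := hzero (hammingNorm c) (by
        simp only [Set.mem_insert_iff, Set.mem_singleton_iff]
        omega)
      have : Nonempty {x : C // hammingNorm (x : Fin (q + 3) → F) = hammingNorm c} :=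
        ⟨⟨⟨c, hc⟩, rfl⟩⟩
      exact Nat.card_pos.ne' hw
  refine ⟨hC ▸ he.finrank_span, hmin, ?_, hC ▸ he.minDist_dualCode, ?_, ?_, ?_, ?_, ?_, hzero⟩
  · have := he.finrank_dualCode
    rw [hC]
    omega
  · rw [hcount, if_pos rfl, if_neg (by omega), if_neg (by omega), if_neg (by omega),
      if_neg (by omega), if_neg (by omega)]
    simp
  · rw [hwq, hq1, hk]
    push_cast
    ring
  · rw [hcount, if_neg (by omega), if_neg (by omega), if_pos (by omega), if_neg (by omega),
      if_pos (by omega), if_pos (by omega), hq1, hq2, hk]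
    push_cast
    ring
  · rw [hcount, if_neg (by omega), if_neg (by omega), if_neg (by omega), if_pos (by omega),
      if_neg (by omega), if_pos (by omega), hq1, hq2, hk]
    push_cast
    ring
  · rw [hcount, if_neg (by omega), if_neg (by omega), if_neg (by omega), if_neg (by omega),
      if_neg (by omega), if_pos (by omega), hq1, hq2, hk]
    push_cast
    ring
end
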